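/- arXiv:2109.11814 — 8 statements merged into one kernel-verified Lean document; each statement's English description precedes it below -/
import Mathlib

section
/- Let F be a q×m complex matrix, H an m×q complex matrix such that I − H·F and I − F·H are invertible, and set P := (I − H·F)⁻¹, Q := (I − F·H)⁻¹. Let Φᵥ be a q×q complex matrix and Φᵣ an m×m complex matrix such that H·Φᵥ·Hᴴ + Φᵣ is invertible, where ᴴ denotes conjugate transpose. Define Φᵤ := P·(H·Φᵥ·Hᴴ + Φᵣ)·Pᴴ and Φ_yu := Q·(Φᵥ·Hᴴ + F·Φᵣ)·Pᴴ. Then Φᵤ is invertible and F = Φ_yu·Φᵤ⁻¹ − Φᵥ·Hᴴ·(H·Φᵥ·Hᴴ + Φᵣ)⁻¹·(I − H·F). -/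
open Matrix

/-- Push-through identity for the sensitivity matrices of a feedback loop. -/
theorem Matrix.inv_one_sub_mul_mul_comm {m n R : Type*} [Fintype m] [DecidableEq m] [Fintype n]
    [DecidableEq n] [CommRing R] (A : Matrix m n R) (B : Matrix n m R)
    (hAB : IsUnit (1 - A * B)) (hBA : IsUnit (1 - B * A)) :
    (1 - A * B)⁻¹ * A = A * (1 - B * A)⁻¹ := by
  rw [Matrix.isUnit_iff_isUnit_det] at hAB hBA
  have h : A * (1 - B * A) = (1 - A * B) * A := by
    rw [Matrix.mul_sub, Matrix.sub_mul, Matrix.mul_one, Matrix.one_mul, Matrix.mul_assoc]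
  calc (1 - A * B)⁻¹ * A = (1 - A * B)⁻¹ * (A * (1 - B * A)) * (1 - B * A)⁻¹ := by
        rw [← Matrix.mul_assoc, Matrix.mul_nonsing_inv_cancel_right _ _ hBA]
    _ = A * (1 - B * A)⁻¹ := by
        rw [h, Matrix.nonsing_inv_mul_cancel_left _ _ hAB]

theorem F_from_spectral_blocks {q m : ℕ}
    (F : Matrix (Fin q) (Fin m) ℂ) (H : Matrix (Fin m) (Fin q) ℂ)
    (Φv : Matrix (Fin q) (Fin q) ℂ) (Φr : Matrix (Fin m) (Fin m) ℂ)
    (hP : IsUnit ((1 : Matrix (Fin m) (Fin m) ℂ) - H * F))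
    (hQ : IsUnit ((1 : Matrix (Fin q) (Fin q) ℂ) - F * H))
    (hS : IsUnit (H * Φv * Hᴴ + Φr)) :
    let P := ((1 : Matrix (Fin m) (Fin m) ℂ) - H * F)⁻¹
    let Q := ((1 : Matrix (Fin q) (Fin q) ℂ) - F * H)⁻¹
    let Φu := P * (H * Φv * Hᴴ + Φr) * Pᴴ
    let Φyu := Q * (Φv * Hᴴ + F * Φr) * Pᴴ
    IsUnit Φu ∧
      F = Φyu * Φu⁻¹ - Φv * Hᴴ * (H * Φv * Hᴴ + Φr)⁻¹ *
        ((1 : Matrix (Fin m) (Fin m) ℂ) - H * F) := by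
  intro P Q Φu Φyu
  have hPinv : IsUnit P := Matrix.isUnit_nonsing_inv_iff.mpr hP
  have hΦu : IsUnit Φu := (hPinv.mul hS).mul hPinv.star
  refine ⟨hΦu, ?_⟩
  have hQF : Q * F = F * P := Matrix.inv_one_sub_mul_mul_comm F H hQ hP
  rw [Matrix.isUnit_iff_isUnit_det] at hP hQ hS hΦu
  have hsplit : Φv * Hᴴ + F * Φr =
      (1 - F * H) * (Φv * Hᴴ) + F * (H * Φv * Hᴴ + Φr) := by
    simp only [Matrix.sub_mul, Matrix.mul_add, Matrix.one_mul, Matrix.mul_assoc]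
    abel
  have hΦyu : Φyu =
      (F + Φv * Hᴴ * (H * Φv * Hᴴ + Φr)⁻¹ * (1 - H * F)) * Φu := by
    calc Φyu = (Φv * Hᴴ + Q * F * (H * Φv * Hᴴ + Φr)) * Pᴴ := by
          simp only [Φyu, Q]
          rw [hsplit, Matrix.mul_add, Matrix.nonsing_inv_mul_cancel_left _ _ hQ,
            Matrix.mul_assoc _ F]
      _ = _ := by
          rw [hQF, Matrix.add_mul, Matrix.add_mul, add_comm]
          congr 1
          · simp only [Φu, Matrix.mul_assoc]
          · simp only [Φu, P]
            rw [Matrix.mul_assoc _ (1 - H * F), Matrix.mul_assoc (1 - H * F)⁻¹,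
              Matrix.mul_nonsing_inv_cancel_left _ _ hP, Matrix.mul_assoc _ (_)⁻¹,
              Matrix.nonsing_inv_mul_cancel_left _ _ hS]
  rw [hΦyu, Matrix.mul_nonsing_inv_cancel_right _ _ hΦu, add_sub_cancel_right]
end

section
/- Let F be a q×m complex matrix, H an m×q complex matrix such that I − H·F and I − F·H are invertible, and set P := (I − H·F)⁻¹, Q := (I − F·H)⁻¹. Let Φᵥ be a q×q complex matrix and Φᵣ an m×m complex matrix such that H·Φᵥ·Hᴴ + Φᵣ is invertible, and define Φᵤ := P·(H·Φᵥ·Hᴴ + Φᵣ)·Pᴴ and Φ_yu := Q·(Φᵥ·Hᴴ + F·Φᵣ)·Pᴴ. Then F = Φ_yu·Φᵤ⁻¹ if and only if Φᵥ·Hᴴ = 0. -/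
open Matrix

/-- The push-through identity `F (1 - H F)⁻¹ = (1 - F H)⁻¹ F`. -/
lemma mul_inv_one_sub_mul_comm {q m : ℕ}
    (F : Matrix (Fin q) (Fin m) ℂ) (H : Matrix (Fin m) (Fin q) ℂ)
    (hP : IsUnit (1 - H * F)) (hQ : IsUnit (1 - F * H)) :
    F * (1 - H * F)⁻¹ = (1 - F * H)⁻¹ * F := by
  have hcomm : (1 - F * H) * F = F * (1 - H * F) := by
    rw [Matrix.sub_mul, Matrix.mul_sub, Matrix.one_mul, Matrix.mul_one, Matrix.mul_assoc]
  rw [← nonsing_inv_mul_cancel_left (1 - F * H) (F * (1 - H * F)⁻¹)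
      ((isUnit_iff_isUnit_det _).1 hQ), ← Matrix.mul_assoc (1 - F * H), hcomm,
    mul_nonsing_inv_cancel_right _ _ ((isUnit_iff_isUnit_det _).1 hP)]

/-- The cross spectrum `Φ_yu` differs from `F Φᵤ` by `Φᵥ Hᴴ Pᴴ`. -/
lemma crossSpectrum_eq {q m : ℕ}
    (F : Matrix (Fin q) (Fin m) ℂ) (H : Matrix (Fin m) (Fin q) ℂ)
    (Φv : Matrix (Fin q) (Fin q) ℂ) (Φr : Matrix (Fin m) (Fin m) ℂ)
    (hP : IsUnit (1 - H * F)) (hQ : IsUnit (1 - F * H)) :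
    (1 - F * H)⁻¹ * (Φv * Hᴴ + F * Φr) * ((1 - H * F)⁻¹)ᴴ =
      F * ((1 - H * F)⁻¹ * (H * Φv * Hᴴ + Φr) * ((1 - H * F)⁻¹)ᴴ) +
        Φv * Hᴴ * ((1 - H * F)⁻¹)ᴴ := by
  have hsplit : Φv * Hᴴ + F * Φr =
      F * (H * Φv * Hᴴ + Φr) + (1 - F * H) * (Φv * Hᴴ) := by
    simp only [Matrix.mul_add, Matrix.sub_mul, Matrix.one_mul, Matrix.mul_assoc]
    abel
  rw [hsplit, Matrix.mul_add, nonsing_inv_mul_cancel_left _ _ ((isUnit_iff_isUnit_det _).1 hQ),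
    Matrix.add_mul, ← Matrix.mul_assoc _ F, ← mul_inv_one_sub_mul_comm F H hP hQ]
  simp only [Matrix.mul_assoc]

theorem F_eq_PhiyuPhiuInv_iff {q m : ℕ}
    (F : Matrix (Fin q) (Fin m) ℂ) (H : Matrix (Fin m) (Fin q) ℂ)
    (Φv : Matrix (Fin q) (Fin q) ℂ) (Φr : Matrix (Fin m) (Fin m) ℂ)
    (hP : IsUnit ((1 : Matrix (Fin m) (Fin m) ℂ) - H * F))
    (hQ : IsUnit ((1 : Matrix (Fin q) (Fin q) ℂ) - F * H))
    (hS : IsUnit (H * Φv * Hᴴ + Φr)) :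
    let P := ((1 : Matrix (Fin m) (Fin m) ℂ) - H * F)⁻¹
    let Q := ((1 : Matrix (Fin q) (Fin q) ℂ) - F * H)⁻¹
    let Φu := P * (H * Φv * Hᴴ + Φr) * Pᴴ
    let Φyu := Q * (Φv * Hᴴ + F * Φr) * Pᴴ
    (F = Φyu * Φu⁻¹ ↔ Φv * Hᴴ = 0) := by
  intro P Q Φu Φyu
  have hPunit : IsUnit P := (isUnit_nonsing_inv_iff).2 hP
  have hPstar : IsUnit Pᴴ := hPunit.star
  have hΦu : IsUnit Φu.det := (isUnit_iff_isUnit_det _).1 ((hPunit.mul hS).mul hPstar)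
  have hΦyu : Φyu = F * Φu + Φv * Hᴴ * Pᴴ := crossSpectrum_eq F H Φv Φr hP hQ
  have hF : F = Φyu * Φu⁻¹ ↔ F * Φu = Φyu := by
    constructor
    · intro h
      rw [h, nonsing_inv_mul_cancel_right _ _ hΦu]
    · intro h
      rw [← h, mul_nonsing_inv_cancel_right _ _ hΦu]
  rw [hF, hΦyu, left_eq_add]
  constructor
  · intro h
    rw [← mul_nonsing_inv_cancel_right Pᴴ (Φv * Hᴴ) ((isUnit_iff_isUnit_det _).1 hPstar), h,
      Matrix.zero_mul]
  · intro h
    rw [h, Matrix.zero_mul]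
end

section
/- Let 𝕂 be a field, A an n×n matrix, B₀ an n×ρ and B₁ an n×k matrix, C₀ a ρ×n and C₁ a k×n matrix, and Σ an invertible ρ×ρ matrix over 𝕂; set Γ₀ := A − B₀·Σ⁻¹·C₀ and W₀₀ := C₀·(z·I − A)⁻¹·B₀ + Σ. Let z ∈ 𝕂 be such that z·I − A and z·I − Γ₀ are invertible. Then the Schur complement S := C₁·(z·I − A)⁻¹·B₁ − C₁·(z·I − A)⁻¹·B₀·W₀₀⁻¹·C₀·(z·I − A)⁻¹·B₁ satisfies S = C₁·(z·I − Γ₀)⁻¹·B₁, and if moreover z ≠ 0 then S = z⁻¹·(C₁·B₁ + C₁·Γ₀·(z·I − Γ₀)⁻¹·B₁). -/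
open Matrix

/-- If `D`, `M` and `M + B * D⁻¹ * C` are invertible, so is `C * M⁻¹ * B + D`. -/
theorem Matrix.isUnit_mul_inv_mul_add {R m l : Type*} [CommRing R] [Fintype m] [DecidableEq m]
    [Fintype l] [DecidableEq l] {M : Matrix m m R} {B : Matrix m l R} {C : Matrix l m R}
    {D : Matrix l l R} (hM : IsUnit M) (hD : IsUnit D) (h : IsUnit (M + B * D⁻¹ * C)) :
    IsUnit (C * M⁻¹ * B + D) := by
  obtain ⟨_⟩ := hM.nonempty_invertible
  obtain ⟨_⟩ := hD.nonempty_invertible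
  obtain ⟨_⟩ := h.nonempty_invertible
  have : Invertible (⅟(⅟M) + B * ⅟D * C) := by
    simpa only [invOf_invOf, invOf_eq_nonsing_inv D]
  have hW : IsUnit (D + C * ⅟M * B) :=
    letI := invertibleAddMulMul D C (⅟M) B
    isUnit_of_invertible _
  rwa [invOf_eq_nonsing_inv, add_comm] at hW

theorem schur_complement_formula {𝕂 : Type*} [Field 𝕂] {n ρ k : ℕ}
    (A : Matrix (Fin n) (Fin n) 𝕂) (B₀ : Matrix (Fin n) (Fin ρ) 𝕂)
    (B₁ : Matrix (Fin n) (Fin k) 𝕂) (C₀ : Matrix (Fin ρ) (Fin n) 𝕂)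
    (C₁ : Matrix (Fin k) (Fin n) 𝕂) (Sg : Matrix (Fin ρ) (Fin ρ) 𝕂)
    (hSg : IsUnit Sg) (z : 𝕂)
    (hA : IsUnit (z • (1 : Matrix (Fin n) (Fin n) 𝕂) - A))
    (hΓ₀ : IsUnit (z • (1 : Matrix (Fin n) (Fin n) 𝕂) - (A - B₀ * Sg⁻¹ * C₀))) :
    let Γ₀ := A - B₀ * Sg⁻¹ * C₀
    let W₀₀ := C₀ * (z • (1 : Matrix (Fin n) (Fin n) 𝕂) - A)⁻¹ * B₀ + Sg
    let S := C₁ * (z • (1 : Matrix (Fin n) (Fin n) 𝕂) - A)⁻¹ * B₁ -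
      C₁ * (z • (1 : Matrix (Fin n) (Fin n) 𝕂) - A)⁻¹ * B₀ * W₀₀⁻¹ *
        (C₀ * (z • (1 : Matrix (Fin n) (Fin n) 𝕂) - A)⁻¹ * B₁)
    S = C₁ * (z • (1 : Matrix (Fin n) (Fin n) 𝕂) - Γ₀)⁻¹ * B₁ ∧
      (z ≠ 0 → S = z⁻¹ • (C₁ * B₁ +
        C₁ * Γ₀ * (z • (1 : Matrix (Fin n) (Fin n) 𝕂) - Γ₀)⁻¹ * B₁)) := by
  intro Γ₀ W₀₀ S
  have hM : z • (1 : Matrix (Fin n) (Fin n) 𝕂) - Γ₀ =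
      (z • (1 : Matrix (Fin n) (Fin n) 𝕂) - A) + B₀ * Sg⁻¹ * C₀ := by
    simp only [Γ₀]; abel
  have hW : IsUnit W₀₀ := isUnit_mul_inv_mul_add hA hSg (hM ▸ hΓ₀)
  have hS : S = C₁ * (z • (1 : Matrix (Fin n) (Fin n) 𝕂) - Γ₀)⁻¹ * B₁ := by
    have hSg' : Sg⁻¹⁻¹ = Sg := nonsing_inv_nonsing_inv Sg ((isUnit_iff_isUnit_det Sg).mp hSg)
    rw [hM, add_mul_mul_inv_eq_sub _ _ _ _ hA (isUnit_nonsing_inv_iff.mpr hSg)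
      (by rwa [hSg', add_comm]), hSg', add_comm Sg]
    simp only [S, W₀₀, Matrix.mul_sub, Matrix.sub_mul, Matrix.mul_assoc]
  refine ⟨hS, fun hz => ?_⟩
  have hR : 1 + Γ₀ * (z • (1 : Matrix (Fin n) (Fin n) 𝕂) - Γ₀)⁻¹ =
      z • (z • (1 : Matrix (Fin n) (Fin n) 𝕂) - Γ₀)⁻¹ := by
    have h := mul_nonsing_inv _ ((isUnit_iff_isUnit_det _).mp hΓ₀)
    rw [Matrix.sub_mul, Matrix.smul_mul, Matrix.one_mul] at h
    exact (sub_eq_iff_eq_add.mp h).symm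
  have hC : C₁ * B₁ + C₁ * Γ₀ * (z • (1 : Matrix (Fin n) (Fin n) 𝕂) - Γ₀)⁻¹ * B₁ =
      C₁ * (1 + Γ₀ * (z • (1 : Matrix (Fin n) (Fin n) 𝕂) - Γ₀)⁻¹) * B₁ := by
    simp only [Matrix.mul_add, Matrix.add_mul, Matrix.mul_one, Matrix.mul_assoc]
  rw [hS, hC, hR, Matrix.mul_smul, Matrix.smul_mul, inv_smul_smul₀ hz]
end

section
/- Let A be a real n×n matrix, B₀ a real n×ρ matrix, B₁ a real n×k matrix, C₀ a real ρ×n matrix, C₁ a real k×n matrix, Σ an invertible real ρ×ρ matrix, and suppose the k×k matrix C₁·B₁ is invertible. Work over the field K = RatFunc ℝ of real rational functions, mapping all the above matrices entrywise into K, and let X denote the rational function z. Then X·I − A is invertible over K, and the (ρ+k)×(ρ+k) block matrix over K given by fromBlocks (C₀·(X·I − A)⁻¹·B₀ + Σ) (C₀·(X·I − A)⁻¹·B₁) (C₁·(X·I − A)⁻¹·B₀) (C₁·(X·I − A)⁻¹·B₁) is invertible. -/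
open Matrix

open Polynomial in
/-- A polynomial matrix that is invertible at `0` stays invertible when evaluated at a
transcendental element. -/
theorem isUnit_map_aeval_of_isUnit_map_eval_zero {F K ι : Type*} [Field F] [Field K] [Algebra F K]
    [Fintype ι] [DecidableEq ι] {w : K} (hw : Transcendental F w) (N : Matrix ι ι F[X])
    (hN : IsUnit (N.map (evalRingHom 0))) :
    IsUnit (N.map (aeval w)) := by
  rw [isUnit_iff_isUnit_det, isUnit_iff_ne_zero] at hN ⊢
  rw [← AlgHom.mapMatrix_apply, ← AlgHom.map_det]
  rw [← RingHom.mapMatrix_apply, ← RingHom.map_det] at hN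
  intro h
  exact hN (by rw [transcendental_iff.mp hw _ h, map_zero])

theorem map_ringHom_smul {R S m n : Type*} [Semiring R] [Semiring S] (f : R →+* S) (r : R)
    (M : Matrix m n R) : (r • M).map f = f r • M.map f := by
  ext; simp

theorem map_ringHom_map_ringHom {R S T m n : Type*} [Semiring R] [Semiring S] [Semiring T]
    (f : R →+* S) (g : S →+* T) (M : Matrix m n R) : (M.map f).map g = M.map (g.comp f) := by
  ext; simp

open Polynomial in
/-- If `Sg` and `C₁ * B₁` are invertible, then so are the pencil `z - A` and the transfer matrix
with state matrix `A` and feedthrough `diag(Sg, 0)`, at any transcendental `z`. -/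
theorem isUnit_transferMatrix_of_transcendental {F K ν ι κ : Type*} [Field F] [Field K]
    [Algebra F K] [Fintype ν] [DecidableEq ν] [Fintype ι] [DecidableEq ι] [Fintype κ]
    [DecidableEq κ] {z : K} (hz : Transcendental F z)
    (A : Matrix ν ν F) (B₀ : Matrix ν ι F) (B₁ : Matrix ν κ F) (C₀ : Matrix ι ν F)
    (C₁ : Matrix κ ν F) (Sg : Matrix ι ι F) (hSg : IsUnit Sg) (hC₁B₁ : IsUnit (C₁ * B₁)) :
    let φ := algebraMap F K
    let R := scalar ν z - A.map φ
    IsUnit R ∧ IsUnit (fromBlocks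
        (C₀.map φ * R⁻¹ * B₀.map φ + Sg.map φ)
        (C₀.map φ * R⁻¹ * B₁.map φ)
        (C₁.map φ * R⁻¹ * B₀.map φ)
        (C₁.map φ * R⁻¹ * B₁.map φ)) := by
  intro φ R
  have hz0 : z ≠ 0 := by
    rintro rfl
    exact hz isAlgebraic_zero
  have hw : Transcendental F z⁻¹ := fun h => hz (IsAlgebraic.inv_iff.mp h)
  set ψ : F[X] →+* K := ((aeval z⁻¹ : F[X] →ₐ[F] K) : F[X] →+* K) with hψ
  set P : Matrix ν ν F[X] := 1 - (X : F[X]) • A.map C with hPdef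
  have hP0 : P.map (evalRingHom 0) = 1 := by
    ext i j
    by_cases h : i = j <;> simp [hPdef, h, Matrix.one_apply]
  have hPψ : IsUnit (P.map ψ) :=
    isUnit_map_aeval_of_isUnit_map_eval_zero hw P (by rw [hP0]; exact isUnit_one)
  have hR : R = z • P.map ψ := by
    ext i j
    by_cases h : i = j <;> simp [R, hPdef, hψ, h, φ, mul_sub] <;> field_simp
  have hd : (P.map ψ).det ≠ 0 := ((isUnit_iff_isUnit_det _).mp hPψ).ne_zero
  have hdet : ψ P.det = (P.map ψ).det := by
    rw [RingHom.map_det, RingHom.mapMatrix_apply]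
  have hadj : P.adjugate.map ψ = (P.map ψ).adjugate := ψ.map_adjugate P
  have hRinv : R⁻¹ = (z⁻¹ * (P.map ψ).det⁻¹) • P.adjugate.map ψ := by
    rw [hadj]
    refine inv_eq_right_inv ?_
    rw [hR, smul_mul_smul_comm, mul_adjugate, smul_smul]
    rw [show z * (z⁻¹ * (P.map ψ).det⁻¹) * (P.map ψ).det = 1 by field_simp, one_smul]
  refine ⟨?_, ?_⟩
  · rw [hR, isUnit_iff_isUnit_det, det_smul, isUnit_iff_ne_zero]
    exact mul_ne_zero (pow_ne_zero _ hz0) hd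
  let N : Matrix (ι ⊕ κ) (ι ⊕ κ) F[X] := fromBlocks
    ((X : F[X]) • (C₀.map C * P.adjugate * B₀.map C) + P.det • Sg.map C)
    ((X : F[X]) • (C₀.map C * P.adjugate * B₁.map C))
    (C₁.map C * P.adjugate * B₀.map C)
    (C₁.map C * P.adjugate * B₁.map C)
  have hadj0 : P.adjugate.map (evalRingHom 0) = 1 := by
    have h := (evalRingHom (0 : F)).map_adjugate P
    rw [RingHom.mapMatrix_apply, RingHom.mapMatrix_apply, hP0, adjugate_one] at h
    exact h
  have hdet0 : evalRingHom 0 P.det = 1 := by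
    rw [RingHom.map_det, RingHom.mapMatrix_apply, hP0, det_one]
  have hevalC : (evalRingHom (0 : F)).comp C = RingHom.id F := by
    ext; simp
  have hN0 : N.map (evalRingHom 0) = fromBlocks Sg 0 (C₁ * B₀) (C₁ * B₁) := by
    simp only [N, fromBlocks_map, Matrix.map_add _ (map_add (evalRingHom (0 : F))),
      map_ringHom_smul, Matrix.map_mul, hadj0, hdet0, map_ringHom_map_ringHom, hevalC]
    simp
  have hNψ : IsUnit (N.map ψ) := by
    refine isUnit_map_aeval_of_isUnit_map_eval_zero hw N ?_
    rw [hN0, isUnit_fromBlocks_zero₁₂]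
    exact ⟨hSg, hC₁B₁⟩
  have hψC : ψ.comp C = φ := by
    ext; simp [hψ, φ]
  have hscale : IsUnit (fromBlocks ((P.map ψ).det⁻¹ • (1 : Matrix ι ι K)) 0 0
      ((z⁻¹ * (P.map ψ).det⁻¹) • (1 : Matrix κ κ K))) := by
    rw [isUnit_fromBlocks_zero₁₂]
    simp [isUnit_iff_isUnit_det, hd, hz0]
  convert hscale.mul hNψ using 1
  have hψX : ψ X = z⁻¹ := by simp [hψ]
  simp only [N, hRinv, fromBlocks_map, Matrix.map_add _ (map_add ψ), map_ringHom_smul,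
    Matrix.map_mul, hdet, map_ringHom_map_ringHom, hψC, hψX, fromBlocks_multiply]
  simp [smul_smul, mul_comm, hd]

set_option synthInstance.maxHeartbeats 1000000 in
theorem u_full_rank_of_C1B1_invertible {n ρ k : ℕ}
    (A : Matrix (Fin n) (Fin n) ℝ) (B₀ : Matrix (Fin n) (Fin ρ) ℝ)
    (B₁ : Matrix (Fin n) (Fin k) ℝ) (C₀ : Matrix (Fin ρ) (Fin n) ℝ)
    (C₁ : Matrix (Fin k) (Fin n) ℝ) (Sg : Matrix (Fin ρ) (Fin ρ) ℝ)
    (hSg : IsUnit Sg) (hC₁B₁ : IsUnit (C₁ * B₁)) :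
    let φ := algebraMap ℝ (RatFunc ℝ)
    let A' := A.map φ
    let zIA : Matrix (Fin n) (Fin n) (RatFunc ℝ) :=
      Matrix.scalar (Fin n) (RatFunc.X : RatFunc ℝ) - A'
    IsUnit zIA ∧
      IsUnit (Matrix.fromBlocks
        (C₀.map φ * zIA⁻¹ * B₀.map φ + Sg.map φ)
        (C₀.map φ * zIA⁻¹ * B₁.map φ)
        (C₁.map φ * zIA⁻¹ * B₀.map φ)
        (C₁.map φ * zIA⁻¹ * B₁.map φ)) :=
  isUnit_transferMatrix_of_transcendental RatFunc.transcendental_X A B₀ B₁ C₀ C₁ Sg hSg hC₁B₁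
end

section
/- Let 𝕂 be a field, A an n×n matrix, B₀ an n×ρ, B₁ an n×k matrix, C₀ a ρ×n, C₁ a k×n matrix, Σ an invertible ρ×ρ matrix over 𝕂, with the k×k matrix C₁·B₁ invertible; set Γ₀ := A − B₀·Σ⁻¹·C₀ and Γ₁ := Γ₀ − B₁·(C₁·B₁)⁻¹·C₁·Γ₀. Let z ∈ 𝕂 with z ≠ 0 be such that z·I − Γ₀ and z·I − Γ₁ are invertible. Then S := C₁·(z·I − Γ₀)⁻¹·B₁ is invertible and B₁·S⁻¹ = z·(z·I − Γ₀)·(z·I − Γ₁)⁻¹·B₁·(C₁·B₁)⁻¹. -/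
open Matrix

/-- The inverse of `C (zI - G)⁻¹ B`, multiplied on the left by `B`, in terms of the resolvent of
`G - B (C B)⁻¹ C G`. -/
theorem schur_inverse_of_isUnit {𝕂 n k : Type*} [Field 𝕂] [Fintype n] [DecidableEq n]
    [Fintype k] [DecidableEq k] (G : Matrix n n 𝕂) (B : Matrix n k 𝕂) (C : Matrix k n 𝕂)
    (hCB : IsUnit (C * B)) {z : 𝕂} (hM : IsUnit (z • (1 : Matrix n n 𝕂) - G))
    (hN : IsUnit (z • (1 : Matrix n n 𝕂) - (G - B * (C * B)⁻¹ * C * G))) :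
    IsUnit (C * (z • (1 : Matrix n n 𝕂) - G)⁻¹ * B) ∧
      B * (C * (z • (1 : Matrix n n 𝕂) - G)⁻¹ * B)⁻¹ =
        z • ((z • (1 : Matrix n n 𝕂) - G) *
          (z • (1 : Matrix n n 𝕂) - (G - B * (C * B)⁻¹ * C * G))⁻¹ * B * (C * B)⁻¹) := by
  rw [Matrix.isUnit_iff_isUnit_det] at hCB hM hN
  set M := z • (1 : Matrix n n 𝕂) - G with hMdef
  set N := z • (1 : Matrix n n 𝕂) - (G - B * (C * B)⁻¹ * C * G) with hNdef
  have hDr : C * B * (C * B)⁻¹ = 1 := Matrix.mul_nonsing_inv _ hCB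
  have hDl : (C * B)⁻¹ * (C * B) = 1 := Matrix.nonsing_inv_mul _ hCB
  have hNM : N = M - B * (C * B)⁻¹ * C * M + z • (B * (C * B)⁻¹ * C) := by
    rw [hNdef, hMdef, Matrix.mul_sub, Matrix.mul_smul, Matrix.mul_one]
    abel
  have hCP : C * (B * (C * B)⁻¹ * C) = C := by
    rw [← Matrix.mul_assoc, ← Matrix.mul_assoc, hDr, Matrix.one_mul]
  have hCN : C * N = z • C := by
    rw [hNM, Matrix.mul_add, Matrix.mul_sub, ← Matrix.mul_assoc, hCP, Matrix.mul_smul, hCP,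
      sub_self, zero_add]
  have hCNi : z • (C * N⁻¹) = C := by
    rw [← Matrix.smul_mul, ← hCN, Matrix.mul_nonsing_inv_cancel_right _ _ hN]
  have hPN : N - B * (C * B)⁻¹ * C * N = M - B * (C * B)⁻¹ * C * M := by
    rw [Matrix.mul_assoc _ C N, hCN, Matrix.mul_smul, hNM]
    abel
  have hMX : M * N⁻¹ * B = B * ((C * B)⁻¹ * C * (M * N⁻¹ * B)) := by
    have h := congrArg (fun Y => Y * (N⁻¹ * B)) hPN
    simp only [Matrix.sub_mul, Matrix.mul_assoc] at h
    rw [Matrix.mul_nonsing_inv_cancel_left _ _ hN, hDl, Matrix.mul_one, sub_self] at h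
    simp only [Matrix.mul_assoc]
    exact sub_eq_zero.mp h.symm
  set T := (C * B)⁻¹ * C * (M * N⁻¹ * B)
  have hST : C * M⁻¹ * B * (z • (T * (C * B)⁻¹)) = 1 := by
    calc C * M⁻¹ * B * (z • (T * (C * B)⁻¹))
        = z • (C * (M⁻¹ * (B * T)) * (C * B)⁻¹) := by
          simp only [Matrix.mul_smul, Matrix.mul_assoc]
      _ = z • (C * N⁻¹) * B * (C * B)⁻¹ := by
          rw [← hMX, Matrix.mul_assoc M, Matrix.nonsing_inv_mul_cancel_left _ _ hM]
          simp only [Matrix.smul_mul, Matrix.mul_assoc]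
      _ = 1 := by rw [hCNi, hDr]
  refine ⟨IsUnit.of_mul_eq_one _ hST, ?_⟩
  rw [Matrix.inv_eq_right_inv hST, hMX, Matrix.mul_smul, Matrix.mul_assoc B]

theorem schur_inverse_formula {𝕂 : Type*} [Field 𝕂] {n ρ k : ℕ}
    (A : Matrix (Fin n) (Fin n) 𝕂) (B₀ : Matrix (Fin n) (Fin ρ) 𝕂)
    (B₁ : Matrix (Fin n) (Fin k) 𝕂) (C₀ : Matrix (Fin ρ) (Fin n) 𝕂)
    (C₁ : Matrix (Fin k) (Fin n) 𝕂) (Sg : Matrix (Fin ρ) (Fin ρ) 𝕂)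
    (hSg : IsUnit Sg) (hC₁B₁ : IsUnit (C₁ * B₁)) (z : 𝕂) (hz : z ≠ 0)
    (hΓ₀ : IsUnit (z • (1 : Matrix (Fin n) (Fin n) 𝕂) - (A - B₀ * Sg⁻¹ * C₀)))
    (hΓ₁ : IsUnit (z • (1 : Matrix (Fin n) (Fin n) 𝕂) -
      ((A - B₀ * Sg⁻¹ * C₀) - B₁ * (C₁ * B₁)⁻¹ * C₁ * (A - B₀ * Sg⁻¹ * C₀)))) :
    let Γ₀ := A - B₀ * Sg⁻¹ * C₀
    let Γ₁ := Γ₀ - B₁ * (C₁ * B₁)⁻¹ * C₁ * Γ₀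
    let S := C₁ * (z • (1 : Matrix (Fin n) (Fin n) 𝕂) - Γ₀)⁻¹ * B₁
    IsUnit S ∧
      B₁ * S⁻¹ = z • ((z • (1 : Matrix (Fin n) (Fin n) 𝕂) - Γ₀) *
        (z • (1 : Matrix (Fin n) (Fin n) 𝕂) - Γ₁)⁻¹ * B₁ * (C₁ * B₁)⁻¹) := by
  exact schur_inverse_of_isUnit _ B₁ C₁ hC₁B₁ hΓ₀ hΓ₁
end

section
/- Let 𝕂 be a field, A an n×n matrix, B₀ an n×ρ, B₁ an n×k matrix, C₀ a ρ×n, C₁ a k×n, C₂ a q×n matrix, and Σ an invertible ρ×ρ matrix over 𝕂, with C₁·B₁ invertible; set Γ₀ := A − B₀·Σ⁻¹·C₀ and Γ₁ := Γ₀ − B₁·(C₁·B₁)⁻¹·C₁·Γ₀. Let z ∈ 𝕂 with z ≠ 0 be such that z·I − A, z·I − Γ₀ and z·I − Γ₁ are invertible. Define W₀₀ := C₀·(z·I−A)⁻¹·B₀ + Σ and W_jk := C_j·(z·I−A)⁻¹·B_k for (j,k) ≠ (0,0) with j ∈ {0,1,2}, k ∈ {0,1}, and set F₀ := C₂·(z·I−Γ₁)⁻¹·(I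 − B₁·(C₁·B₁)⁻¹·C₁)·B₀·Σ⁻¹ and F₁ := z·C₂·(z·I−Γ₁)⁻¹·B₁·(C₁·B₁)⁻¹. Then F₀·W₀₀ + F₁·W₁₀ = W₂₀ and F₀·W₀₁ + F₁·W₁₁ = W₂₁. -/
open Matrix

/-- If `R` and `G` are the resolvents of `A` and `Γ₁ = (1 - P) (A - S)` at `z`, then
`G ((1 - P) S + z P) R = R - G (1 - P)`. -/
theorem resolvent_mul_feedback_mul_resolvent {𝕂 R : Type*} [CommRing 𝕂] [Ring R] [Algebra 𝕂 R]
    {A S P X G : R} {z : 𝕂} (hX : (z • (1 : R) - A) * X = 1)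
    (hG : G * (z • (1 : R) - ((A - S) - P * (A - S))) = 1) :
    G * ((1 - P) * S + z • P) * X = X - G * (1 - P) := by
  have hsplit : (1 - P) * S + z • P =
      (z • (1 : R) - ((A - S) - P * (A - S))) - (1 - P) * (z • (1 : R) - A) := by
    simp only [sub_mul, mul_sub, one_mul, mul_smul_comm, mul_one, smul_sub]
    abel
  rw [hsplit, mul_sub, hG, sub_mul, one_mul, mul_assoc, mul_assoc, hX, mul_one]

theorem F_maps_u_to_y {𝕂 : Type*} [Field 𝕂] {n ρ k q : ℕ}
    (A : Matrix (Fin n) (Fin n) 𝕂) (B₀ : Matrix (Fin n) (Fin ρ) 𝕂)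
    (B₁ : Matrix (Fin n) (Fin k) 𝕂) (C₀ : Matrix (Fin ρ) (Fin n) 𝕂)
    (C₁ : Matrix (Fin k) (Fin n) 𝕂) (C₂ : Matrix (Fin q) (Fin n) 𝕂)
    (Sg : Matrix (Fin ρ) (Fin ρ) 𝕂)
    (hSg : IsUnit Sg) (hC₁B₁ : IsUnit (C₁ * B₁)) (z : 𝕂) (hz : z ≠ 0)
    (hA : IsUnit (z • (1 : Matrix (Fin n) (Fin n) 𝕂) - A))
    (hΓ₀ : IsUnit (z • (1 : Matrix (Fin n) (Fin n) 𝕂) - (A - B₀ * Sg⁻¹ * C₀)))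
    (hΓ₁ : IsUnit (z • (1 : Matrix (Fin n) (Fin n) 𝕂) -
      ((A - B₀ * Sg⁻¹ * C₀) - B₁ * (C₁ * B₁)⁻¹ * C₁ * (A - B₀ * Sg⁻¹ * C₀)))) :
    let Γ₀ := A - B₀ * Sg⁻¹ * C₀
    let Γ₁ := Γ₀ - B₁ * (C₁ * B₁)⁻¹ * C₁ * Γ₀
    let zIA := z • (1 : Matrix (Fin n) (Fin n) 𝕂) - A
    let W₀₀ := C₀ * zIA⁻¹ * B₀ + Sg
    let W₀₁ := C₀ * zIA⁻¹ * B₁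
    let W₁₀ := C₁ * zIA⁻¹ * B₀
    let W₁₁ := C₁ * zIA⁻¹ * B₁
    let W₂₀ := C₂ * zIA⁻¹ * B₀
    let W₂₁ := C₂ * zIA⁻¹ * B₁
    let F₀ := C₂ * (z • (1 : Matrix (Fin n) (Fin n) 𝕂) - Γ₁)⁻¹ *
      ((1 : Matrix (Fin n) (Fin n) 𝕂) - B₁ * (C₁ * B₁)⁻¹ * C₁) * B₀ * Sg⁻¹
    let F₁ := z • (C₂ * (z • (1 : Matrix (Fin n) (Fin n) 𝕂) - Γ₁)⁻¹ *
      B₁ * (C₁ * B₁)⁻¹)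
    F₀ * W₀₀ + F₁ * W₁₀ = W₂₀ ∧ F₀ * W₀₁ + F₁ * W₁₁ = W₂₁ := by
  intro Γ₀ Γ₁ zIA W₀₀ W₀₁ W₁₀ W₁₁ W₂₀ W₂₁ F₀ F₁
  have hSg' : Sg⁻¹ * Sg = 1 := nonsing_inv_mul _ ((isUnit_iff_isUnit_det _).mp hSg)
  have hCB : (C₁ * B₁)⁻¹ * (C₁ * B₁) = 1 :=
    nonsing_inv_mul _ ((isUnit_iff_isUnit_det _).mp hC₁B₁)
  have hX : zIA * zIA⁻¹ = 1 := mul_nonsing_inv _ ((isUnit_iff_isUnit_det _).mp hA)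
  have hG := nonsing_inv_mul _ ((isUnit_iff_isUnit_det _).mp hΓ₁)
  have hres := resolvent_mul_feedback_mul_resolvent hX hG
  set P := B₁ * (C₁ * B₁)⁻¹ * C₁ with hP
  set G := (z • (1 : Matrix (Fin n) (Fin n) 𝕂) - Γ₁)⁻¹ with hGdef
  have hPB : (1 - P) * B₁ = 0 := by
    rw [Matrix.sub_mul, Matrix.one_mul, hP, Matrix.mul_assoc, Matrix.mul_assoc, hCB,
      Matrix.mul_one, sub_self]
  have hF : F₀ * (C₀ * zIA⁻¹) + F₁ * (C₁ * zIA⁻¹) = C₂ * (zIA⁻¹ - G * (1 - P)) := by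
    rw [← hres]
    simp only [F₀, F₁, hP, hGdef, Matrix.mul_add, Matrix.add_mul, Matrix.mul_assoc, Matrix.smul_mul,
      Matrix.mul_smul]
  have hF₀ : F₀ * Sg = C₂ * (G * (1 - P)) * B₀ := by
    simp only [F₀, hP, hGdef, Matrix.mul_assoc, hSg', Matrix.mul_one]
  constructor
  · calc F₀ * W₀₀ + F₁ * W₁₀
        = (F₀ * (C₀ * zIA⁻¹) + F₁ * (C₁ * zIA⁻¹)) * B₀ + F₀ * Sg := by
          simp only [W₀₀, W₁₀, Matrix.mul_add, Matrix.add_mul, Matrix.mul_assoc]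
          abel
      _ = W₂₀ := by
          rw [hF, hF₀, Matrix.mul_sub, Matrix.sub_mul, sub_add_cancel]
  · calc F₀ * W₀₁ + F₁ * W₁₁
        = (F₀ * (C₀ * zIA⁻¹) + F₁ * (C₁ * zIA⁻¹)) * B₁ := by
          simp only [W₀₁, W₁₁, Matrix.add_mul, Matrix.mul_assoc]
      _ = W₂₁ := by
          rw [hF, Matrix.mul_assoc, Matrix.sub_mul, Matrix.mul_assoc G, hPB, Matrix.mul_zero,
            sub_zero, ← Matrix.mul_assoc]
end

section
/- Let 𝕂 be a field, C₁ a k×n matrix and B₁ an n×k matrix over 𝕂 such that the k×k matrix C₁·B₁ is invertible, and let Γ₀ be any n×n matrix over 𝕂. Then the rank of the matrix Γ₁ := (I − B₁·(C₁·B₁)⁻¹·C₁)·Γ₀ satisfies rank Γ₁ ≤ n − k. -/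
open Matrix

theorem rank_Gamma1_le {𝕂 : Type*} [Field 𝕂] {n k : ℕ}
    (C₁ : Matrix (Fin k) (Fin n) 𝕂) (B₁ : Matrix (Fin n) (Fin k) 𝕂)
    (hC₁B₁ : IsUnit (C₁ * B₁)) (Γ₀ : Matrix (Fin n) (Fin n) 𝕂) :
    (((1 : Matrix (Fin n) (Fin n) 𝕂) - B₁ * (C₁ * B₁)⁻¹ * C₁) * Γ₀).rank ≤ n - k := by
  have annihilates : C₁ * ((1 - B₁ * (C₁ * B₁)⁻¹ * C₁) * Γ₀) = 0 := by
    have hdet : IsUnit (C₁ * B₁).det := (Matrix.isUnit_iff_isUnit_det _).mp hC₁B₁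
    rw [← Matrix.mul_assoc, Matrix.mul_sub, Matrix.mul_one, ← Matrix.mul_assoc,
      ← Matrix.mul_assoc, Matrix.mul_nonsing_inv _ hdet, Matrix.one_mul, sub_self,
      Matrix.zero_mul]
  have rank_add_le := Matrix.rank_add_rank_le_card_of_mul_eq_zero annihilates
  have le_rank : k ≤ C₁.rank := by
    simpa [Matrix.rank_of_isUnit _ hC₁B₁] using Matrix.rank_mul_le_left C₁ B₁
  rw [Fintype.card_fin] at rank_add_le
  omega
end

section
/- Let 𝕂 be a field, A an n×n matrix, C₁ an m×n matrix and B an n×m matrix over 𝕂 with C₁·B invertible, and C₂ a q×n matrix; set Γ₁ := (I − B·(C₁·B)⁻¹·C₁)·A. Then for any N, the stacked (N·q)×n matrix O whose i-th block row (for i = 0, …, N−1) is C₂·Γ₁^(i+1) satisfies rank O ≤ n − m. -/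
open Matrix

/-- If `C * B` is invertible, then `1 - B * (C * B)⁻¹ * C` is annihilated by `C` on the left, so
its rank is at most the corank of `C`. -/
theorem rank_one_sub_mul_inv_mul_le {𝕂 m n : Type*} [Field 𝕂] [Fintype m] [DecidableEq m]
    [Fintype n] [DecidableEq n] (C : Matrix m n 𝕂) (B : Matrix n m 𝕂) (hCB : IsUnit (C * B)) :
    (1 - B * (C * B)⁻¹ * C).rank ≤ Fintype.card n - Fintype.card m := by
  have hdet : IsUnit (C * B).det := (Matrix.isUnit_iff_isUnit_det _).mp hCB
  have hmul : C * (1 - B * (C * B)⁻¹ * C) = 0 := by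
    rw [Matrix.mul_sub, Matrix.mul_one, ← Matrix.mul_assoc, ← Matrix.mul_assoc,
      Matrix.mul_nonsing_inv _ hdet, Matrix.one_mul, sub_self]
  have hsum := Matrix.rank_add_rank_le_card_of_mul_eq_zero hmul
  have hC : Fintype.card m ≤ C.rank :=
    (Matrix.rank_of_isUnit _ hCB).symm.le.trans (Matrix.rank_mul_le_left C B)
  omega

theorem observability_matrix_rank_le {𝕂 : Type*} [Field 𝕂] {n m q : ℕ}
    (A : Matrix (Fin n) (Fin n) 𝕂) (C₁ : Matrix (Fin m) (Fin n) 𝕂)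
    (B : Matrix (Fin n) (Fin m) 𝕂) (hC₁B : IsUnit (C₁ * B))
    (C₂ : Matrix (Fin q) (Fin n) 𝕂) (N : ℕ) :
    let Γ₁ := ((1 : Matrix (Fin n) (Fin n) 𝕂) - B * (C₁ * B)⁻¹ * C₁) * A
    let O : Matrix (Fin N × Fin q) (Fin n) 𝕂 :=
      fun p j => (C₂ * Γ₁ ^ ((p.1 : ℕ) + 1)) p.2 j
    O.rank ≤ n - m := by
  intro Γ₁ O
  have hO : O = Matrix.of (fun (p : Fin N × Fin q) j => (C₂ * Γ₁ ^ (p.1 : ℕ)) p.2 j) * Γ₁ := by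
    ext p j
    change (C₂ * Γ₁ ^ ((p.1 : ℕ) + 1)) p.2 j = _
    rw [pow_succ, ← Matrix.mul_assoc]
    rfl
  calc O.rank ≤ Γ₁.rank := hO ▸ Matrix.rank_mul_le_right _ _
    _ ≤ (1 - B * (C₁ * B)⁻¹ * C₁).rank := Matrix.rank_mul_le_left _ _
    _ ≤ n - m := by simpa using rank_one_sub_mul_inv_mul_le C₁ B hC₁B
end
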